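/- arXiv:2305.01356 — 3 statements merged into one kernel-verified Lean document; each statement's English description precedes it below -/
import Mathlib

section
/- For every integer ℓ < 0, every real α with 1/2 < α ≤ 1, every x ∈ ℝ^{d−1} and every z > 0, the cube-based horobox R(x, z, α·2^ℓ/√(d−1), 2^ℓ) has diameter exactly 2·arsinh((1/2)·√((α²·4^ℓ + (2^{2^ℓ} − 1)²)/2^{2^ℓ})). -/
/-- Hyperbolic distance in the half-space model, for points given as
pairs `(x, z)` with `x : EuclideanSpace ℝ (Fin n)` and `z : ℝ` (assumed positive). -/
noncomputable def hdist {n : ℕ} (p q : EuclideanSpace ℝ (Fin n) × ℝ) : ℝ :=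
  2 * Real.arsinh ((1 / 2) * Real.sqrt ((‖p.1 - q.1‖ ^ 2 + (p.2 - q.2) ^ 2) / (p.2 * q.2)))

/-- The cube-based horobox `R(x,z,w,h)`: the closed Euclidean box with opposite
corners `(x, z)` and `(x + z·(w,…,w), z·2^h)`. -/
def horobox {n : ℕ} (x : EuclideanSpace ℝ (Fin n)) (z w h : ℝ) :
    Set (EuclideanSpace ℝ (Fin n) × ℝ) :=
  {p | (∀ i, x i ≤ p.1 i ∧ p.1 i ≤ x i + z * w) ∧ z ≤ p.2 ∧ p.2 ≤ z * (2 : ℝ) ^ h}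

/-- The hyperbolic diameter of a set: the supremum of pairwise distances. -/
noncomputable def hdiam {n : ℕ} (S : Set (EuclideanSpace ℝ (Fin n) × ℝ)) : ℝ :=
  sSup {r : ℝ | ∃ p ∈ S, ∃ q ∈ S, r = hdist p q}


/-- Among heights in `[1, H]`, the two extreme ones maximize `(A + (u - v)²) / (u v)`
as soon as `A ≤ H - 1`. -/
lemma mul_add_sub_sq_le_of_le {A H u v : ℝ} (hA : 0 ≤ A) (hAH : A ≤ H - 1)
    (hu : 1 ≤ u) (huv : u ≤ v) (hv : v ≤ H) :
    H * (A + (u - v) ^ 2) ≤ (A + (H - 1) ^ 2) * (u * v) := by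
  have hH : 1 ≤ H := by linarith
  have hdiag : H * A ≤ (A + (H - 1) ^ 2) * u ^ 2 := by
    have h₁ : H * A ≤ A + (H - 1) ^ 2 := by nlinarith
    have h₂ : (0 : ℝ) ≤ A + (H - 1) ^ 2 := by positivity
    nlinarith [mul_nonneg h₂ (show 0 ≤ u ^ 2 - 1 by nlinarith)]
  have htop : H * (A + (u - H) ^ 2) ≤ (A + (H - 1) ^ 2) * (u * H) := by
    have h₁ : 0 ≤ (u - 1) * (A + H ^ 2 - u) :=
      mul_nonneg (by linarith) (by nlinarith)
    nlinarith [mul_nonneg (show 0 ≤ H by linarith) h₁]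
  rcases (huv.trans hv).eq_or_lt with rfl | huH
  · obtain rfl : v = u := le_antisymm hv huv
    nlinarith
  · refine le_of_mul_le_mul_right ?_ (sub_pos.2 huH)
    nlinarith [mul_le_mul_of_nonneg_left hdiag (sub_nonneg.2 hv),
      mul_le_mul_of_nonneg_left htop (sub_nonneg.2 huv),
      mul_nonneg (mul_nonneg (mul_nonneg (show 0 ≤ H by linarith) (sub_nonneg.2 huv))
        (sub_nonneg.2 hv)) (sub_nonneg.2 huH.le)]

lemma mul_add_sub_sq_le {A H u v : ℝ} (hA : 0 ≤ A) (hAH : A ≤ H - 1)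
    (hu : 1 ≤ u) (huH : u ≤ H) (hv : 1 ≤ v) (hvH : v ≤ H) :
    H * (A + (u - v) ^ 2) ≤ (A + (H - 1) ^ 2) * (u * v) := by
  rcases le_total u v with h | h
  · exact mul_add_sub_sq_le_of_le hA hAH hu h hvH
  · simpa only [mul_comm u v, sub_sq_comm u v] using mul_add_sub_sq_le_of_le hA hAH hv h huH

/-- The diameter of a cube-based horobox that is not too wide is the distance between
its two opposite corners. -/
lemma hdiam_horobox {n : ℕ} (x : EuclideanSpace ℝ (Fin n)) {z w h : ℝ} (hz : 0 < z)
    (hw : 0 ≤ w) (hwh : n * w ^ 2 ≤ (2 : ℝ) ^ h - 1) :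
    hdiam (horobox x z w h) =
      2 * Real.arsinh ((1 / 2) *
        Real.sqrt ((n * w ^ 2 + ((2 : ℝ) ^ h - 1) ^ 2) / (2 : ℝ) ^ h)) := by
  unfold hdiam horobox
  set H : ℝ := (2 : ℝ) ^ h
  have hA : 0 ≤ n * w ^ 2 := by positivity
  have hH : 1 ≤ H := by linarith
  have hH0 : 0 < H := by linarith
  refine IsGreatest.csSup_eq ⟨?_, ?_⟩
  · refine ⟨(x, z), ⟨fun i => ⟨le_rfl, ?_⟩, le_rfl, ?_⟩,
      (WithLp.toLp 2 fun i => x i + z * w, z * H), ⟨fun i => ⟨?_, le_rfl⟩, ?_, le_rfl⟩, ?_⟩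
    · have := mul_nonneg hz.le hw
      simpa using this
    · exact le_mul_of_one_le_right hz.le hH
    · have := mul_nonneg hz.le hw
      simpa using this
    · exact le_mul_of_one_le_right hz.le hH
    · have hnorm : ‖x - WithLp.toLp 2 fun i => x i + z * w‖ ^ 2 = n * (z * w) ^ 2 := by
        simp [EuclideanSpace.norm_sq_eq, mul_pow]
      simp only [hdist, hnorm]
      congr 4
      field_simp
      ring
  · rintro r ⟨p, ⟨hp, hp₁, hp₂⟩, q, ⟨hq, hq₁, hq₂⟩, rfl⟩
    have hnorm : ‖p.1 - q.1‖ ^ 2 ≤ z ^ 2 * (n * w ^ 2) := by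
      rw [EuclideanSpace.norm_sq_eq]
      calc ∑ i, ‖(p.1 - q.1) i‖ ^ 2 ≤ ∑ _i : Fin n, (z * w) ^ 2 := by
            refine Finset.sum_le_sum fun i _ => pow_le_pow_left₀ (norm_nonneg _) ?_ 2
            rw [PiLp.sub_apply, Real.norm_eq_abs, abs_le]
            constructor <;> linarith [hp i, hq i]
        _ = z ^ 2 * (n * w ^ 2) := by simp; ring
    have hratio : (‖p.1 - q.1‖ ^ 2 + (p.2 - q.2) ^ 2) / (p.2 * q.2) ≤
        (n * w ^ 2 + (H - 1) ^ 2) / H := by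
      have hp0 : 0 < p.2 := hz.trans_le hp₁
      have hq0 : 0 < q.2 := hz.trans_le hq₁
      have key := mul_add_sub_sq_le hA hwh ((one_le_div hz).2 hp₁) ((div_le_iff₀' hz).2 hp₂)
        ((one_le_div hz).2 hq₁) ((div_le_iff₀' hz).2 hq₂)
      rw [div_le_div_iff₀ (mul_pos hp0 hq0) hH0]
      calc (‖p.1 - q.1‖ ^ 2 + (p.2 - q.2) ^ 2) * H
          ≤ (z ^ 2 * (n * w ^ 2) + (p.2 - q.2) ^ 2) * H := by gcongr
        _ = z ^ 2 * (H * (n * w ^ 2 + (p.2 / z - q.2 / z) ^ 2)) := by field_simp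
        _ ≤ z ^ 2 * ((n * w ^ 2 + (H - 1) ^ 2) * (p.2 / z * (q.2 / z))) := by gcongr
        _ = (n * w ^ 2 + (H - 1) ^ 2) * (p.2 * q.2) := by field_simp
    unfold hdist
    have := Real.arsinh_le_arsinh.2
      (mul_le_mul_of_nonneg_left (Real.sqrt_le_sqrt hratio) (by norm_num : (0 : ℝ) ≤ 1 / 2))
    linarith

lemma sq_le_two_rpow_sub_one {s : ℝ} (hs₀ : 0 ≤ s) (hs : s ≤ 1 / 2) :
    s ^ 2 ≤ (2 : ℝ) ^ s - 1 := by
  have h := Real.add_one_le_exp (Real.log 2 * s)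
  rw [Real.exp_mul, Real.exp_log two_pos] at h
  nlinarith [Real.log_two_gt_d9]

/-- For every integer `ℓ < 0` and `α ∈ (1/2, 1]`, the cube-based horobox
`R(x, z, α·2^ℓ/√(d−1), 2^ℓ)` has diameter
`2·arsinh((1/2)·√((α²·4^ℓ + (2^(2^ℓ) − 1)²)/2^(2^ℓ)))`. -/
theorem stmt_5 (d : ℕ) (hd : 2 ≤ d) (ℓ : ℤ) (hℓ : ℓ < 0)
    (α : ℝ) (hα₁ : 1 / 2 < α) (hα₂ : α ≤ 1)
    (x : EuclideanSpace ℝ (Fin (d - 1))) (z : ℝ) (hz : 0 < z) :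
    hdiam (horobox x z (α * (2 : ℝ) ^ (ℓ : ℝ) / Real.sqrt ((d : ℝ) - 1))
        ((2 : ℝ) ^ (ℓ : ℝ))) =
      2 * Real.arsinh ((1 / 2) *
        Real.sqrt ((α ^ 2 * (4 : ℝ) ^ (ℓ : ℝ) + ((2 : ℝ) ^ ((2 : ℝ) ^ (ℓ : ℝ)) - 1) ^ 2) /
          (2 : ℝ) ^ ((2 : ℝ) ^ (ℓ : ℝ)))) := by
  have hs₀ : 0 < (2 : ℝ) ^ (ℓ : ℝ) := by positivity
  have hs : (2 : ℝ) ^ (ℓ : ℝ) ≤ 1 / 2 := by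
    have hℓ' : (ℓ : ℝ) ≤ -1 := by exact_mod_cast Int.le_sub_one_of_lt hℓ
    calc (2 : ℝ) ^ (ℓ : ℝ) ≤ (2 : ℝ) ^ (-1 : ℝ) :=
          Real.rpow_le_rpow_of_exponent_le one_le_two hℓ'
      _ = 1 / 2 := by rw [Real.rpow_neg_one]; norm_num
  have h4 : (4 : ℝ) ^ (ℓ : ℝ) = ((2 : ℝ) ^ (ℓ : ℝ)) ^ 2 := by
    rw [← Real.rpow_mul_natCast two_pos.le, mul_comm, Real.rpow_mul two_pos.le]
    norm_num
  have hcast : ((d - 1 : ℕ) : ℝ) = (d : ℝ) - 1 := by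
    rw [Nat.cast_sub (by omega), Nat.cast_one]
  have hd₁ : 0 < (d : ℝ) - 1 := by
    have : (2 : ℝ) ≤ d := by exact_mod_cast hd
    linarith
  rw [h4]
  set s : ℝ := (2 : ℝ) ^ (ℓ : ℝ)
  have hw : ((d - 1 : ℕ) : ℝ) * (α * s / Real.sqrt ((d : ℝ) - 1)) ^ 2 = α ^ 2 * s ^ 2 := by
    rw [hcast, div_pow, Real.sq_sqrt hd₁.le]
    field_simp
  rw [hdiam_horobox x hz (by positivity), hw]
  rw [hw]
  have hα : α ^ 2 ≤ 1 := by nlinarith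
  nlinarith [sq_le_two_rpow_sub_one hs₀.le hs, mul_le_mul_of_nonneg_right hα (sq_nonneg s)]
end

section
/- There is a universal constant c > 0 with the following property. For every integer d ≥ 2, every integer ℓ, and every w > 0 such that either (ℓ ≥ 0 and w = 2^{2^ℓ − 1}/√(d−1)) or (ℓ < 0 and w = α·2^ℓ/√(d−1) for some α with 1/2 < α ≤ 1), one has min(2^ℓ·ln 2, ln(1 + w)) ≥ (c/√d)·D, where D is the diameter of the cube-based horobox R(x, z, w, 2^ℓ) (for any x ∈ ℝ^{d−1}, z > 0). In other words, hyperbolic quadtree cells are Ω(1/√d)-fat: they contain a hyperbolic ball whose diameter is at least c/√d times the cell's diameter. -/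
open Real in
/-- Two points of a horobox are at distance at most `2 arsinh t`, where `2t` bounds the hypotenuse
of its normalized width diagonal and its normalized height. -/
theorem hdist_le_of_mem_horobox {n : ℕ} {x : EuclideanSpace ℝ (Fin n)} {z w h t : ℝ}
    (hz : 0 < z) (ht : 0 ≤ t) (hS : n * w ^ 2 + ((2 : ℝ) ^ h - 1) ^ 2 ≤ (2 * t) ^ 2)
    {p q : EuclideanSpace ℝ (Fin n) × ℝ} (hp : p ∈ horobox x z w h) (hq : q ∈ horobox x z w h) :
    hdist p q ≤ 2 * arsinh t := by
  obtain ⟨hp1, hp2, hp3⟩ := hp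
  obtain ⟨hq1, hq2, hq3⟩ := hq
  have hnorm : ‖p.1 - q.1‖ ^ 2 ≤ n * (z * w) ^ 2 := by
    rw [EuclideanSpace.norm_sq_eq]
    calc ∑ i, ‖(p.1 - q.1) i‖ ^ 2 ≤ ∑ _i : Fin n, (z * w) ^ 2 := by
          refine Finset.sum_le_sum fun i _ => ?_
          rw [Real.norm_eq_abs, sq_abs, PiLp.sub_apply]
          exact sq_le_sq' (by linarith [hp1 i, hq1 i]) (by linarith [hp1 i, hq1 i])
      _ = n * (z * w) ^ 2 := by simp
  have hvert : (p.2 - q.2) ^ 2 ≤ (z * ((2 : ℝ) ^ h - 1)) ^ 2 :=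
    sq_le_sq' (by linarith) (by linarith)
  have hzz : z ^ 2 ≤ p.2 * q.2 := by
    rw [sq]; exact mul_le_mul hp2 hq2 hz.le (hz.le.trans hp2)
  have hquot : (‖p.1 - q.1‖ ^ 2 + (p.2 - q.2) ^ 2) / (p.2 * q.2) ≤ (2 * t) ^ 2 := by
    rw [div_le_iff₀ (lt_of_lt_of_le (by positivity) hzz)]
    calc _ ≤ (n * w ^ 2 + ((2 : ℝ) ^ h - 1) ^ 2) * z ^ 2 := by linarith
      _ ≤ (2 * t) ^ 2 * (p.2 * q.2) := by gcongr
  have hsqrt := Real.sqrt_le_sqrt hquot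
  rw [Real.sqrt_sq (by positivity)] at hsqrt
  unfold hdist
  gcongr
  linarith

open Real in
theorem hdiam_horobox_le {n : ℕ} (x : EuclideanSpace ℝ (Fin n)) {z w h t : ℝ}
    (hz : 0 < z) (ht : 0 ≤ t) (hS : n * w ^ 2 + ((2 : ℝ) ^ h - 1) ^ 2 ≤ (2 * t) ^ 2) :
    hdiam (horobox x z w h) ≤ 2 * arsinh t := by
  refine Real.sSup_le ?_ (by have := arsinh_nonneg_iff.2 ht; positivity)
  rintro r ⟨p, hp, q, hq, rfl⟩
  exact hdist_le_of_mem_horobox hz ht hS hp hq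

theorem Real.arsinh_le_self {t : ℝ} (ht : 0 ≤ t) : Real.arsinh t ≤ t := by
  rw [← Real.sinh_le_sinh, Real.sinh_arsinh]
  exact Real.self_le_sinh_iff.2 ht

theorem Real.two_rpow_le_sinh_two_mul {L : ℝ} (hL : 1 ≤ L) :
    (2 : ℝ) ^ L ≤ Real.sinh (2 * L) := by
  have hexp : (2 : ℝ) ^ L ≤ Real.exp L := by
    rw [← Real.exp_one_rpow]
    exact Real.rpow_le_rpow (by norm_num) (by linarith [Real.add_one_le_exp 1]) (by linarith)
  have hsinh : 1 ≤ Real.sinh L := hL.trans (Real.self_le_sinh_iff.2 (by linarith))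
  have hcosh : Real.exp L ≤ 2 * Real.cosh L := by
    rw [Real.cosh_eq]; linarith [Real.exp_pos (-L)]
  rw [Real.sinh_two_mul]
  nlinarith [Real.cosh_pos L]

/-- The diameter of a cell of height at least one is at most four times its height. -/
theorem hdiam_cell_le_of_one_le {n : ℕ} (x : EuclideanSpace ℝ (Fin n)) {z w L : ℝ} (hz : 0 < z)
    (hL : 1 ≤ L) (hw : n * w ^ 2 = ((2 : ℝ) ^ (L - 1)) ^ 2) :
    hdiam (horobox x z w L) ≤ 4 * L := by
  have hu : (2 : ℝ) ≤ 2 ^ L := by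
    simpa using Real.rpow_le_rpow_of_exponent_le (by norm_num : (1 : ℝ) ≤ 2) hL
  have hD := hdiam_horobox_le x (w := w) (h := L) (t := 2 ^ L) hz (by positivity) (by
    rw [hw, Real.rpow_sub_one (by norm_num)]; nlinarith)
  have harsinh : Real.arsinh (2 ^ L) ≤ 2 * L := by
    rw [← Real.sinh_le_sinh, Real.sinh_arsinh]
    exact Real.two_rpow_le_sinh_two_mul hL
  linarith

theorem hdiam_cell_le_of_le_one {n : ℕ} (x : EuclideanSpace ℝ (Fin n)) {z w L : ℝ} (hz : 0 < z)
    (hL₀ : 0 ≤ L) (hL₁ : L ≤ 1) (hw : n * w ^ 2 ≤ L ^ 2) :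
    hdiam (horobox x z w L) ≤ 4 * L := by
  have hu₀ : (1 : ℝ) ≤ 2 ^ L := Real.one_le_rpow (by norm_num) hL₀
  have hu₁ : (2 : ℝ) ^ L ≤ 1 + L := by
    have := rpow_one_add_le_one_add_mul_self (s := 1) (by norm_num) hL₀ hL₁
    norm_num at this
    exact this
  have hD := hdiam_horobox_le x (w := w) (h := L) (t := L) hz hL₀ (by nlinarith)
  linarith [Real.arsinh_le_self hL₀]

theorem le_log_one_add_of_one_le {L s : ℝ} (hL : 1 ≤ L) (hs : 1 ≤ s) :
    L / (4 * s) ≤ Real.log (1 + (2 : ℝ) ^ (L - 1) / s) := by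
  have hs₀ : 0 < s := by linarith
  set A : ℝ := 2 ^ (L - 1) with hA
  have hA₁ : 1 ≤ A := Real.one_le_rpow (by norm_num) (by linarith)
  have hlog₁ : Real.log 2 ≤ Real.log (1 + A) := Real.log_le_log (by norm_num) (by linarith)
  have hlog₂ : (L - 1) * Real.log 2 ≤ Real.log (1 + A) := by
    rw [← Real.log_rpow (by norm_num)]
    exact Real.log_le_log (by positivity) (by linarith)
  have hlog : L / 4 ≤ Real.log (1 + A) := by nlinarith [Real.log_two_gt_d9]
  have hbern : (1 + A) ^ s⁻¹ ≤ 1 + s⁻¹ * A :=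
    rpow_one_add_le_one_add_mul_self (by linarith) (by positivity) (inv_le_one_of_one_le₀ hs)
  calc L / (4 * s) = s⁻¹ * (L / 4) := by field_simp
    _ ≤ s⁻¹ * Real.log (1 + A) := by gcongr
    _ = Real.log ((1 + A) ^ s⁻¹) := (Real.log_rpow (by linarith) _).symm
    _ ≤ Real.log (1 + s⁻¹ * A) := Real.log_le_log (by positivity) hbern
    _ = Real.log (1 + A / s) := by rw [div_eq_inv_mul]

theorem half_le_log_one_add {w : ℝ} (hw₀ : 0 ≤ w) (hw₁ : w ≤ 1) : w / 2 ≤ Real.log (1 + w) := by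
  have hinv := Real.one_sub_inv_le_log_of_pos (x := 1 + w) (by linarith)
  have hdiv : w / 2 ≤ 1 - (1 + w)⁻¹ := by
    rw [show 1 - (1 + w)⁻¹ = w / (1 + w) by field_simp; ring]
    gcongr
    linarith
  linarith

/-- Hyperbolic quadtree cells are `Ω(1/√d)`-fat: there is a universal constant `c > 0`
such that the inscribed-ball diameter `min(2^ℓ·ln 2, ln(1+w))` of a level-`ℓ` cell
(width `w = 2^(2^ℓ−1)/√(d−1)` if `ℓ ≥ 0`, and `w = α·2^ℓ/√(d−1)` with `α ∈ (1/2,1]`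
if `ℓ < 0`) is at least `(c/√d)` times the cell's diameter. -/
theorem stmt_9 :
    ∃ c : ℝ, 0 < c ∧
      ∀ d : ℕ, 2 ≤ d → ∀ ℓ : ℤ, ∀ w : ℝ, 0 < w →
        ((0 ≤ ℓ ∧ w = (2 : ℝ) ^ ((2 : ℝ) ^ (ℓ : ℝ) - 1) / Real.sqrt ((d : ℝ) - 1)) ∨
          (ℓ < 0 ∧ ∃ α : ℝ, 1 / 2 < α ∧ α ≤ 1 ∧
            w = α * (2 : ℝ) ^ (ℓ : ℝ) / Real.sqrt ((d : ℝ) - 1))) →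
        ∀ (x : EuclideanSpace ℝ (Fin (d - 1))) (z : ℝ), 0 < z →
          min ((2 : ℝ) ^ (ℓ : ℝ) * Real.log 2) (Real.log (1 + w)) ≥
            (c / Real.sqrt d) * hdiam (horobox x z w ((2 : ℝ) ^ (ℓ : ℝ))) := by
  refine ⟨1 / 16, by norm_num, fun d hd ℓ w hw hcell x z hz => ?_⟩
  set L : ℝ := (2 : ℝ) ^ (ℓ : ℝ) with hLdef
  set s : ℝ := Real.sqrt ((d : ℝ) - 1) with hsdef
  have hL : 0 < L := by positivity
  have hd₁ : (1 : ℝ) ≤ (d : ℝ) - 1 := by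
    have : (2 : ℝ) ≤ d := by exact_mod_cast hd
    linarith
  have hs : 1 ≤ s := Real.one_le_sqrt.2 hd₁
  have hs₀ : 0 < s := by linarith
  have hn : ((d - 1 : ℕ) : ℝ) = s ^ 2 := by
    rw [Real.sq_sqrt (by linarith), Nat.cast_sub (by omega), Nat.cast_one]
  have hsd : s ≤ Real.sqrt d := Real.sqrt_le_sqrt (by linarith)
  obtain ⟨hD, hlog⟩ : hdiam (horobox x z w L) ≤ 4 * L ∧ L / (4 * s) ≤ Real.log (1 + w) := by
    rcases hcell with ⟨hℓ, rfl⟩ | ⟨hℓ, α, hα₀, hα₁, rfl⟩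
    · have hL₁ : 1 ≤ L := Real.one_le_rpow (by norm_num) (by exact_mod_cast hℓ)
      refine ⟨hdiam_cell_le_of_one_le x hz hL₁ ?_, le_log_one_add_of_one_le hL₁ hs⟩
      rw [hn, div_pow]
      field_simp
    · have hL₁ : L ≤ 1 := Real.rpow_le_one_of_one_le_of_nonpos (by norm_num) (by exact_mod_cast hℓ.le)
      have hαL : α * L ≤ L := mul_le_of_le_one_left hL.le hα₁
      refine ⟨hdiam_cell_le_of_le_one x hz hL.le hL₁ ?_, ?_⟩
      · calc ((d - 1 : ℕ) : ℝ) * (α * L / s) ^ 2 = (α * L) ^ 2 := by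
              rw [hn, div_pow]
              field_simp
          _ ≤ L ^ 2 := by gcongr
      · refine le_trans ?_ (half_le_log_one_add hw.le ((div_le_one hs₀).2 (by linarith)))
        rw [div_div, div_le_div_iff₀ (by positivity) (by positivity)]
        nlinarith [mul_pos hL hs₀]
  have hheight : L / (4 * s) ≤ L * Real.log 2 := by
    calc L / (4 * s) ≤ L / 4 := by gcongr; linarith
      _ ≤ L * Real.log 2 := by nlinarith [Real.log_two_gt_d9]
  calc 1 / 16 / Real.sqrt d * hdiam (horobox x z w L) ≤ 1 / 16 / s * (4 * L) := by
        calc _ ≤ 1 / 16 / Real.sqrt d * (4 * L) := by gcongr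
          _ ≤ _ := by gcongr
    _ = L / (4 * s) := by field_simp; norm_num
    _ ≤ min (L * Real.log 2) (Real.log (1 + w)) := le_min hheight hlog
end

section
/- There is a universal constant c > 0 such that: (i) for every integer ℓ ≥ 0, 2·arsinh(2^{2^ℓ − 2}) ≤ c·2^ℓ; and (ii) for every integer ℓ < 0 and every real α with 0 < α ≤ 1, 2·arsinh( (1/2)·√((α²·4^ℓ + (2^{2^ℓ} − 1)²)/2^{2^ℓ}) ) ≤ c·2^ℓ. That is, the diameter of a level-ℓ hyperbolic quadtree cell is O(2^ℓ). -/
/-- `arsinh` lies below the identity on the nonnegative reals. -/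
theorem Real.arsinh_le_self_s16 {x : ℝ} (hx : 0 ≤ x) : Real.arsinh x ≤ x := by
  rw [← Real.sinh_le_sinh, Real.sinh_arsinh]
  exact Real.self_le_sinh_iff.2 hx

theorem arsinh_two_rpow_sub_two_le {s : ℝ} (hs : 1 ≤ s) :
    Real.arsinh ((2 : ℝ) ^ (s - 2)) ≤ s := by
  rw [← Real.sinh_le_sinh, Real.sinh_arsinh, Real.sinh_eq, Real.rpow_sub two_pos, Real.rpow_two]
  have h2 : (2 : ℝ) ^ s ≤ Real.exp s := by
    rw [← Real.exp_one_rpow s]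
    exact Real.rpow_le_rpow zero_le_two (by linarith [Real.add_one_le_exp 1]) (by linarith)
  have h3 : 2 ≤ Real.exp s := by linarith [Real.add_one_le_exp s]
  have h4 : Real.exp (-s) ≤ 1 := Real.exp_le_one_iff.2 (by linarith)
  linarith

theorem arsinh_half_sqrt_le {s α : ℝ} (hs : 0 ≤ s) (hs1 : s ≤ 1) (hα : 0 ≤ α) (hα1 : α ≤ 1) :
    Real.arsinh (1 / 2 * √((α ^ 2 * s ^ 2 + ((2 : ℝ) ^ s - 1) ^ 2) / (2 : ℝ) ^ s)) ≤ s := by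
  refine (Real.arsinh_le_self_s16 (by positivity)).trans ?_
  have h1 : 1 ≤ (2 : ℝ) ^ s := Real.one_le_rpow one_le_two hs
  have h2 : (2 : ℝ) ^ s ≤ 1 + s := by
    have := rpow_one_add_le_one_add_mul_self (s := 1) (by norm_num) hs hs1
    norm_num at this
    exact this
  have hsq : ((2 : ℝ) ^ s - 1) ^ 2 ≤ s ^ 2 :=
    pow_le_pow_left₀ (by linarith) (by linarith) 2
  have hαs : α ^ 2 * s ^ 2 ≤ s ^ 2 :=
    mul_le_of_le_one_left (sq_nonneg s) (pow_le_one₀ hα hα1)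
  have hroot : √((α ^ 2 * s ^ 2 + ((2 : ℝ) ^ s - 1) ^ 2) / (2 : ℝ) ^ s) ≤ 2 * s := by
    refine Real.sqrt_le_iff.2 ⟨by positivity, (div_le_self (by positivity) h1).trans ?_⟩
    nlinarith [sq_nonneg s]
  linarith

/-- There is a universal constant `c > 0` such that the diameter of a level-`ℓ`
hyperbolic quadtree cell is at most `c·2^ℓ`: (i) for `ℓ ≥ 0` the diameter is
`2·arsinh(2^(2^ℓ−2))`, and (ii) for `ℓ < 0` and parameter `0 < α ≤ 1` it is
`2·arsinh((1/2)·√((α²·4^ℓ + (2^(2^ℓ)−1)²)/2^(2^ℓ)))`. -/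
theorem stmt_16 :
    ∃ c : ℝ, 0 < c ∧
      (∀ ℓ : ℤ, 0 ≤ ℓ →
        2 * Real.arsinh ((2 : ℝ) ^ ((2 : ℝ) ^ (ℓ : ℝ) - 2)) ≤ c * (2 : ℝ) ^ (ℓ : ℝ)) ∧
      (∀ ℓ : ℤ, ℓ < 0 → ∀ α : ℝ, 0 < α → α ≤ 1 →
        2 * Real.arsinh ((1 / 2) *
            Real.sqrt ((α ^ 2 * (4 : ℝ) ^ (ℓ : ℝ) +
                ((2 : ℝ) ^ ((2 : ℝ) ^ (ℓ : ℝ)) - 1) ^ 2) /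
              (2 : ℝ) ^ ((2 : ℝ) ^ (ℓ : ℝ)))) ≤ c * (2 : ℝ) ^ (ℓ : ℝ)) := by
  refine ⟨2, two_pos, fun ℓ hℓ => ?_, fun ℓ hℓ α hα hα1 => ?_⟩
  · have hs : (1 : ℝ) ≤ (2 : ℝ) ^ (ℓ : ℝ) :=
      Real.one_le_rpow one_le_two (by exact_mod_cast hℓ)
    have := arsinh_two_rpow_sub_two_le hs
    linarith
  · have hs : (0 : ℝ) < (2 : ℝ) ^ (ℓ : ℝ) := by positivity
    have hs1 : (2 : ℝ) ^ (ℓ : ℝ) ≤ 1 :=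
      Real.rpow_le_one_of_one_le_of_nonpos one_le_two (by exact_mod_cast hℓ.le)
    have h4 : (4 : ℝ) ^ (ℓ : ℝ) = ((2 : ℝ) ^ (ℓ : ℝ)) ^ 2 := by
      rw [show (4 : ℝ) = 2 * 2 by norm_num, Real.mul_rpow zero_le_two zero_le_two, sq]
    rw [h4]
    have := arsinh_half_sqrt_le hs.le hs1 hα.le hα1
    linarith
end
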